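/- Assume β > ϖ1 in either Case [N1] or Case [N2]. Then every positive super-solution u of equation (E) in Ω∖{0} satisfies liminf_{|x|→0} |x|^{ϖ1} u(x) > 0. -/

import Mathlib

open MeasureTheory Filter Topology Real RealInnerProductSpace

noncomputable section

/-- The gradient factor `G_τ(x,z,ξ) = z^τ ‖ξ‖^(1-τ) / ‖x‖^(τ+1)`.
For `τ = 0` this equals `‖ξ‖ / ‖x‖`, since `z ^ (0:ℝ) = 1` for real powers. -/
def Gt {N : ℕ} (τ : ℝ) (x : EuclideanSpace ℝ (Fin N)) (z : ℝ)
    (ξ : EuclideanSpace ℝ (Fin N)) : ℝ :=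
  z ^ τ * ‖ξ‖ ^ (1 - τ) / ‖x‖ ^ (τ + 1)

/-- Test functions: `C¹` functions with compact support contained in `Ω \ {0}`. -/
def IsTestFun {N : ℕ} (Ω : Set (EuclideanSpace ℝ (Fin N)))
    (φ : EuclideanSpace ℝ (Fin N) → ℝ) : Prop :=
  ContDiff ℝ 1 φ ∧ HasCompactSupport φ ∧ tsupport φ ⊆ Ω \ {0}

/-- The distributional pairing of equation (E) with a test function `φ`:
`∫ ∇u·∇φ + (N-2+2ρ) ∫ ((x·∇u)/|x|²) φ - λ ∫ G_τ(x,u,∇u) φ + ∫ |x|^θ u^q φ`. -/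
def weakE (N : ℕ) (ρ lam τ θ q : ℝ) (Ω : Set (EuclideanSpace ℝ (Fin N)))
    (u φ : EuclideanSpace ℝ (Fin N) → ℝ) : ℝ :=
  (∫ x in Ω \ {0}, ⟪gradient u x, gradient φ x⟫)
    + ((N : ℝ) - 2 + 2 * ρ) * (∫ x in Ω \ {0}, ⟪x, gradient u x⟫ / ‖x‖ ^ 2 * φ x)
    - lam * (∫ x in Ω \ {0}, Gt τ x (u x) (gradient u x) * φ x)
    + ∫ x in Ω \ {0}, ‖x‖ ^ θ * u x ^ q * φ x

/-- A positive `C¹` function on `Ω \ {0}`. -/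
def PosC1 {N : ℕ} (Ω : Set (EuclideanSpace ℝ (Fin N)))
    (u : EuclideanSpace ℝ (Fin N) → ℝ) : Prop :=
  ContDiffOn ℝ 1 u (Ω \ {0}) ∧ ∀ x ∈ Ω \ {0}, 0 < u x

/-- Positive distributional solution of equation (E) in `Ω \ {0}`. -/
def IsSolutionE (N : ℕ) (ρ lam τ θ q : ℝ) (Ω : Set (EuclideanSpace ℝ (Fin N)))
    (u : EuclideanSpace ℝ (Fin N) → ℝ) : Prop :=
  PosC1 Ω u ∧ ∀ φ, IsTestFun Ω φ → weakE N ρ lam τ θ q Ω u φ = 0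

/-- Positive sub-solution of equation (E) in `Ω \ {0}`. -/
def IsSubSolutionE (N : ℕ) (ρ lam τ θ q : ℝ) (Ω : Set (EuclideanSpace ℝ (Fin N)))
    (u : EuclideanSpace ℝ (Fin N) → ℝ) : Prop :=
  PosC1 Ω u ∧ ∀ φ, IsTestFun Ω φ → (∀ x, 0 ≤ φ x) → weakE N ρ lam τ θ q Ω u φ ≤ 0

/-- Positive super-solution of equation (E) in `Ω \ {0}`. -/
def IsSuperSolutionE (N : ℕ) (ρ lam τ θ q : ℝ) (Ω : Set (EuclideanSpace ℝ (Fin N)))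
    (u : EuclideanSpace ℝ (Fin N) → ℝ) : Prop :=
  PosC1 Ω u ∧ ∀ φ, IsTestFun Ω φ → (∀ x, 0 ≤ φ x) → 0 ≤ weakE N ρ lam τ θ q Ω u φ

/-- `f_ρ(t) = t (t + 2ρ) + λ |t|^(1-τ)`. -/
def fRho (ρ lam τ t : ℝ) : ℝ := t * (t + 2 * ρ) + lam * |t| ^ (1 - τ)

/-- `Υ = ((τ+1)/(2τ)) (λτ)^(1/(τ+1))`. -/
def Upsilon (lam τ : ℝ) : ℝ := ((τ + 1) / (2 * τ)) * (lam * τ) ^ (1 / (τ + 1))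

/-- Case [N₀]: (a) `τ = 0` and `λ ≥ 2ρ`, or (b) `λ > 0`, `τ ∈ (0,1)` and `ρ < Υ`. -/
def CaseN0 (ρ lam τ : ℝ) : Prop :=
  (τ = 0 ∧ 2 * ρ ≤ lam) ∨ (0 < lam ∧ 0 < τ ∧ τ < 1 ∧ ρ < Upsilon lam τ)

/-- Case [N₁]: (a) `τ = 0` and `λ < 2ρ`, or (b) `λ < 0` and `τ ∈ (0,1)`. -/
def CaseN1 (ρ lam τ : ℝ) : Prop :=
  (τ = 0 ∧ lam < 2 * ρ) ∨ (lam < 0 ∧ 0 < τ ∧ τ < 1)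

/-- Case [N₂]: `λ > 0`, `τ ∈ (0,1)` and `ρ ≥ Υ`. -/
def CaseN2 (ρ lam τ : ℝ) : Prop :=
  0 < lam ∧ 0 < τ ∧ τ < 1 ∧ Upsilon lam τ ≤ ρ

/-- `w` is the smallest negative root of `f_ρ` (i.e. `w = ϖ₁`). -/
def IsMinNegRoot (ρ lam τ w : ℝ) : Prop :=
  w < 0 ∧ fRho ρ lam τ w = 0 ∧ ∀ t, t < 0 → fRho ρ lam τ t = 0 → w ≤ t

/-- `w` is the largest negative root of `f_ρ` (i.e. `w = ϖ₂`). -/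
def IsMaxNegRoot (ρ lam τ w : ℝ) : Prop :=
  w < 0 ∧ fRho ρ lam τ w = 0 ∧ ∀ t, t < 0 → fRho ρ lam τ t = 0 → t ≤ w

/-- `Φ_{ϖ₂}(r)`: equal to `r^(-ϖ₂)` if `ρ > Υ` and to `r^(-ϖ₂) |log r|^(2/(1+τ))` if `ρ = Υ`. -/
def Phi2 (ρ lam τ w2 r : ℝ) : ℝ :=
  if ρ = Upsilon lam τ then r ^ (-w2) * |Real.log r| ^ (2 / (1 + τ)) else r ^ (-w2)

/-- `Ψ_{ϖ₁}(t)`: equal to `t^(-ϖ₁)` if `ρ > Υ` and to `t^(-ϖ₁) (log t)^(2/(1+τ))` if `ρ = Υ`. -/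
def Psi1 (ρ lam τ w1 t : ℝ) : ℝ :=
  if ρ = Upsilon lam τ then t ^ (-w1) * (Real.log t) ^ (2 / (1 + τ)) else t ^ (-w1)

/-- The radial operator `L_{ρ,λ,τ}[P](r) = P'' + (1-2ρ) P'/r + λ P^τ |P'|^(1-τ)/r^(1+τ)`. -/
def Lrad (ρ lam τ : ℝ) (P : ℝ → ℝ) (r : ℝ) : ℝ :=
  deriv (deriv P) r + (1 - 2 * ρ) * deriv P r / r
    + lam * P r ^ τ * |deriv P r| ^ (1 - τ) / r ^ (1 + τ)

/-- The Laplacian of `u` at `x`, as the trace of the second derivative. -/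
def lapl {N : ℕ} (u : EuclideanSpace ℝ (Fin N) → ℝ) (x : EuclideanSpace ℝ (Fin N)) : ℝ :=
  ∑ i : Fin N, iteratedFDeriv ℝ 2 u x ![EuclideanSpace.single i 1, EuclideanSpace.single i 1]

/-- A function that vanishes off a compact set and is continuous at its points is integrable. -/
lemma integrable_of_continuousAt_of_eq_zero {N : ℕ} {K : Set (EuclideanSpace ℝ (Fin N))}
    (hK : IsCompact K) {F : EuclideanSpace ℝ (Fin N) → ℝ} (h0 : ∀ x, x ∉ K → F x = 0)
    (hF : ∀ x ∈ K, ContinuousAt F x) : Integrable F := by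
  have hsub : tsupport F ⊆ K := by
    refine closure_minimal (fun x hx => ?_) hK.isClosed
    by_contra hxK
    exact hx (h0 x hxK)
  exact (continuous_of_tsupport fun x hx => hF x (hsub hx)).integrable_of_hasCompactSupport
    (hK.of_isClosed_subset (isClosed_tsupport F) hsub)

/-- A function vanishing off a compact set and `C¹` near its points is `C¹`. -/
lemma contDiff_of_contDiffAt_of_eq_zero {N : ℕ} {G : Type*} [NormedAddCommGroup G]
    [NormedSpace ℝ G] {K : Set (EuclideanSpace ℝ (Fin N))}
    (hK : IsCompact K) {F : EuclideanSpace ℝ (Fin N) → G} (h0 : ∀ x, x ∉ K → F x = 0)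
    (hF : ∀ x ∈ K, ContDiffAt ℝ 1 F x) : ContDiff ℝ 1 F := by
  rw [contDiff_iff_contDiffAt]
  intro x
  by_cases hx : x ∈ K
  · exact hF x hx
  · refine (contDiffAt_const (c := (0 : G))).congr_of_eventuallyEq ?_
    filter_upwards [hK.isClosed.isOpen_compl.mem_nhds hx] with y hy using h0 y hy

lemma hasDerivAt_posPart_sq (t : ℝ) :
    HasDerivAt (fun s : ℝ => max s 0 ^ 2) (2 * max t 0) t := by
  rcases lt_trichotomy t 0 with ht | ht | ht
  · rw [max_eq_right ht.le, mul_zero]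
    refine (hasDerivAt_const t (0 : ℝ)).congr_of_eventuallyEq ?_
    filter_upwards [Iio_mem_nhds ht] with s hs
    simp [max_eq_right (Set.mem_Iio.1 hs).le]
  · subst ht
    rw [max_self, mul_zero, hasDerivAt_iff_isLittleO_nhds_zero]
    have h2 : (fun h : ℝ => h ^ 2) =o[𝓝 0] fun h : ℝ => h := by
      simpa using Asymptotics.isLittleO_pow_id (𝕜 := ℝ) (n := 2) (by norm_num)
    refine Asymptotics.IsBigO.trans_isLittleO (Asymptotics.IsBigO.of_bound 1 ?_) h2
    refine Eventually.of_forall fun h => ?_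
    rcases le_total h 0 with hh | hh <;> simp [hh, sq_nonneg]
  · rw [max_eq_left ht.le]
    refine ((hasDerivAt_pow 2 t).congr_of_eventuallyEq ?_).congr_deriv (by simp)
    filter_upwards [Ioi_mem_nhds ht] with s hs
    simp [max_eq_left (Set.mem_Ioi.1 hs).le]

lemma contDiff_posPart_sq : ContDiff ℝ 1 (fun s : ℝ => max s 0 ^ 2) := by
  rw [contDiff_one_iff_deriv]
  refine ⟨fun t => (hasDerivAt_posPart_sq t).differentiableAt, ?_⟩
  rw [funext fun t => (hasDerivAt_posPart_sq t).deriv]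
  fun_prop

/-- The divergence of a compactly supported `C¹` vector field has zero integral. -/
lemma integral_divergence_eq_zero {N : ℕ}
    {Y : EuclideanSpace ℝ (Fin N) → EuclideanSpace ℝ (Fin N)}
    (hY : ContDiff ℝ 1 Y) (hc : HasCompactSupport Y) :
    ∫ x, ∑ i, (fderiv ℝ Y x (EuclideanSpace.single i 1)) i = 0 := by
  have hcont : Continuous (fderiv ℝ Y) := hY.continuous_fderiv (by norm_num)
  have hint (i : Fin N) : Integrable fun x => (fderiv ℝ Y x (EuclideanSpace.single i 1)) i := by
    refine Continuous.integrable_of_hasCompactSupport (by fun_prop) ?_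
    exact (hc.fderiv (𝕜 := ℝ)).comp_left
      (g := fun L : EuclideanSpace ℝ (Fin N) →L[ℝ] EuclideanSpace ℝ (Fin N) =>
        (L (EuclideanSpace.single i 1)) i) (by simp)
  rw [integral_finsetSum _ fun i _ => hint i]
  refine Finset.sum_eq_zero fun i _ => ?_
  have hd (x) : fderiv ℝ (fun y => Y y i) x (EuclideanSpace.single i 1)
      = (fderiv ℝ Y x (EuclideanSpace.single i 1)) i := by
    have h1 := (hY.differentiable (by norm_num) x).hasFDerivAt
    have h2 : HasFDerivAt (fun y => Y y i)
      ((EuclideanSpace.proj i : EuclideanSpace ℝ (Fin N) →L[ℝ] ℝ).comp (fderiv ℝ Y x)) x :=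
      (EuclideanSpace.proj i : EuclideanSpace ℝ (Fin N) →L[ℝ] ℝ).hasFDerivAt.comp x h1
    rw [h2.fderiv]
    rfl
  have hYi : Integrable fun x => Y x i := by
    refine Continuous.integrable_of_hasCompactSupport (by have := hY.continuous; fun_prop) ?_
    exact hc.comp_left (g := fun y : EuclideanSpace ℝ (Fin N) => y i) (by simp)
  have key := integral_mul_fderiv_eq_neg_fderiv_mul_of_integrable
    (μ := (volume : Measure (EuclideanSpace ℝ (Fin N))))
    (f := fun _ => (1 : ℝ)) (g := fun x => Y x i) (v := EuclideanSpace.single i 1)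
    (by simp) (by simpa [hd] using hint i) (by simpa using hYi)
    (fun x _ => differentiableAt_const _)
    (fun x _ => by have := hY.differentiable (by norm_num) x; fun_prop)
  simpa [hd] using key

/-- Divergence of a scalar multiple of a vector field. -/
lemma divergence_smul {N : ℕ} {φ : EuclideanSpace ℝ (Fin N) → ℝ}
    {X : EuclideanSpace ℝ (Fin N) → EuclideanSpace ℝ (Fin N)} {x : EuclideanSpace ℝ (Fin N)}
    (hφ : DifferentiableAt ℝ φ x) (hX : DifferentiableAt ℝ X x) :
    ∑ i, (fderiv ℝ (fun y => φ y • X y) x (EuclideanSpace.single i 1)) i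
      = ⟪X x, gradient φ x⟫ + (∑ i, (fderiv ℝ X x (EuclideanSpace.single i 1)) i) * φ x := by
  rw [fderiv_fun_smul hφ hX, Finset.sum_mul, PiLp.inner_apply, ← Finset.sum_add_distrib]
  refine Finset.sum_congr rfl fun i _ => ?_
  have : gradient φ x i = fderiv ℝ φ x (EuclideanSpace.single i 1) := by
    rw [← inner_gradient_left, EuclideanSpace.inner_single_right]
    simp
  simp [this]
  ring

lemma continuousAt_gradient_of_contDiffAt {N : ℕ} {u : EuclideanSpace ℝ (Fin N) → ℝ}
    {x : EuclideanSpace ℝ (Fin N)} (hu : ContDiffAt ℝ 1 u x) : ContinuousAt (gradient u) x :=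
  (InnerProductSpace.toDual ℝ (EuclideanSpace ℝ (Fin N))).symm.continuous.continuousAt.comp
    (hu.continuousAt_fderiv (by norm_num))

/-- The lower order part `(N-2+2ρ) (x·∇u)/|x|² - λ G_τ(x,u,∇u) + |x|^θ u^q` of equation (E). -/
def lowerOrderE (N : ℕ) (ρ lam τ θ q : ℝ) (u : EuclideanSpace ℝ (Fin N) → ℝ)
    (x : EuclideanSpace ℝ (Fin N)) : ℝ :=
  ((N : ℝ) - 2 + 2 * ρ) * (⟪x, gradient u x⟫ / ‖x‖ ^ 2)
    - lam * Gt τ x (u x) (gradient u x) + ‖x‖ ^ θ * u x ^ q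

lemma continuousAt_Gt {N : ℕ} {τ : ℝ} (hτ1 : τ < 1) {u : EuclideanSpace ℝ (Fin N) → ℝ}
    {x : EuclideanSpace ℝ (Fin N)} (hx : x ≠ 0) (hu : ContDiffAt ℝ 1 u x) (hpos : 0 < u x) :
    ContinuousAt (fun y => Gt τ y (u y) (gradient u y)) x := by
  have hg := continuousAt_gradient_of_contDiffAt hu
  have hn : ‖x‖ ≠ 0 := norm_ne_zero_iff.2 hx
  unfold Gt
  refine ((hu.continuousAt.rpow_const (Or.inl hpos.ne')).mul
    (hg.norm.rpow_const (Or.inr (by linarith)))).div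
    (continuous_norm.continuousAt.rpow_const (Or.inl hn)) ?_
  exact (Real.rpow_pos_of_pos (norm_pos_iff.2 hx) _).ne'

lemma continuousAt_drift {N : ℕ} {u : EuclideanSpace ℝ (Fin N) → ℝ}
    {x : EuclideanSpace ℝ (Fin N)} (hx : x ≠ 0) (hu : ContDiffAt ℝ 1 u x) :
    ContinuousAt (fun y => ⟪y, gradient u y⟫ / ‖y‖ ^ 2) x := by
  have hg := continuousAt_gradient_of_contDiffAt hu
  have hn : ‖x‖ ≠ 0 := norm_ne_zero_iff.2 hx
  exact (ContinuousAt.inner (𝕜 := ℝ) continuousAt_id hg).div (by fun_prop) (by positivity)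

lemma continuousAt_absorption {N : ℕ} {θ q : ℝ} {u : EuclideanSpace ℝ (Fin N) → ℝ}
    {x : EuclideanSpace ℝ (Fin N)} (hx : x ≠ 0) (hu : ContDiffAt ℝ 1 u x) (hpos : 0 < u x) :
    ContinuousAt (fun y => ‖y‖ ^ θ * u y ^ q) x :=
  (continuous_norm.continuousAt.rpow_const (Or.inl (norm_ne_zero_iff.2 hx))).mul
    (hu.continuousAt.rpow_const (Or.inl hpos.ne'))

lemma continuousAt_lowerOrderE {N : ℕ} {ρ lam τ θ q : ℝ} (hτ1 : τ < 1)
    {u : EuclideanSpace ℝ (Fin N) → ℝ} {x : EuclideanSpace ℝ (Fin N)} (hx : x ≠ 0)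
    (hu : ContDiffAt ℝ 1 u x) (hpos : 0 < u x) :
    ContinuousAt (lowerOrderE N ρ lam τ θ q u) x :=
  ((continuousAt_const.mul (continuousAt_drift hx hu)).sub
    (continuousAt_const.mul (continuousAt_Gt hτ1 hx hu hpos))).add
    (continuousAt_absorption hx hu hpos)

/-- A `C²` function `V` with gradient `X` cannot cross a super-solution `u` from below on a
compactly contained ball on which it is a strict sub-solution relative to `u`. -/
lemma false_of_local_bump {N : ℕ} {ρ lam τ θ q : ℝ} (hτ1 : τ < 1)
    {Ω : Set (EuclideanSpace ℝ (Fin N))} (hΩ : IsOpen Ω)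
    {u : EuclideanSpace ℝ (Fin N) → ℝ} (hu : IsSuperSolutionE N ρ lam τ θ q Ω u)
    {x0 : EuclideanSpace ℝ (Fin N)} {s R : ℝ} (hs : 0 < s) (hsR : s < R)
    (hball : Metric.ball x0 R ⊆ Ω \ {0})
    {V : EuclideanSpace ℝ (Fin N) → ℝ} {X : EuclideanSpace ℝ (Fin N) → EuclideanSpace ℝ (Fin N)}
    (hV : ∀ x ∈ Metric.ball x0 R, HasGradientAt V (X x) x)
    (hX : ∀ x ∈ Metric.ball x0 R, ContDiffAt ℝ 1 X x)
    (hsub : ∀ x ∈ Metric.ball x0 R, lowerOrderE N ρ lam τ θ q u x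
      < ∑ i, (fderiv ℝ X x (EuclideanSpace.single i 1)) i)
    (hout : ∀ x ∈ Metric.ball x0 R, x ∉ Metric.closedBall x0 s → V x ≤ u x)
    (hin : u x0 < V x0) : False := by
  classical
  obtain ⟨⟨huC, hupos⟩, hweak⟩ := hu
  have hopen : IsOpen (Ω \ {0}) := hΩ.sdiff isClosed_singleton
  set K := Metric.closedBall x0 s
  have hK : IsCompact K := isCompact_closedBall x0 s
  have hKB : K ⊆ Metric.ball x0 R := Metric.closedBall_subset_ball hsR
  have hBnhds (x) (hx : x ∈ Metric.ball x0 R) : Metric.ball x0 R ∈ 𝓝 x :=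
    Metric.isOpen_ball.mem_nhds hx
  have huAt (x) (hx : x ∈ Metric.ball x0 R) : ContDiffAt ℝ 1 u x :=
    huC.contDiffAt (hopen.mem_nhds (hball hx))
  have hne (x) (hx : x ∈ Metric.ball x0 R) : x ≠ 0 := fun h => (hball hx).2 (by simp [h])
  have hVAt (x) (hx : x ∈ Metric.ball x0 R) : ContDiffAt ℝ 1 V x := by
    rw [contDiffAt_one_iff]
    refine ⟨fun y => InnerProductSpace.toDual ℝ _ (X y), Metric.ball x0 R, hBnhds x hx, ?_,
      fun y hy => (hV y hy).hasFDerivAt⟩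
    exact (InnerProductSpace.toDual ℝ (EuclideanSpace ℝ (Fin N))).continuous.comp_continuousOn
      fun y hy => (hX y hy).continuousAt.continuousWithinAt
  set φ : EuclideanSpace ℝ (Fin N) → ℝ :=
    fun x => if x ∈ Metric.ball x0 R then max (V x - u x) 0 ^ 2 else 0 with hφdef
  have hφeq (x) (hx : x ∈ Metric.ball x0 R) : φ =ᶠ[𝓝 x] fun y => max (V y - u y) 0 ^ 2 := by
    filter_upwards [hBnhds x hx] with y hy
    simp only [hφdef, if_pos hy]
  have hφ0 (x) (hx : x ∉ K) : φ x = 0 := by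
    by_cases hxB : x ∈ Metric.ball x0 R
    · have := hout x hxB hx
      simp [hφdef, max_eq_right (sub_nonpos.2 this)]
    · simp only [hφdef, if_neg hxB]
  have hφnn (x) : 0 ≤ φ x := by
    simp only [hφdef]; split_ifs <;> positivity
  have hφC : ContDiff ℝ 1 φ := by
    refine contDiff_of_contDiffAt_of_eq_zero hK hφ0 fun x hx => ?_
    refine ContDiffAt.congr_of_eventuallyEq ?_ (hφeq x (hKB hx))
    exact contDiff_posPart_sq.contDiffAt.comp x ((hVAt x (hKB hx)).sub (huAt x (hKB hx)))
  have hφsupp : tsupport φ ⊆ K := by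
    refine closure_minimal (fun x hx => ?_) hK.isClosed
    by_contra hxK
    exact hx (hφ0 x hxK)
  have hφc : HasCompactSupport φ := hK.of_isClosed_subset (isClosed_tsupport φ) hφsupp
  have hg0 (x) (hx : x ∉ K) : gradient φ x = 0 := by
    have : φ =ᶠ[𝓝 x] fun _ => (0 : ℝ) := by
      filter_upwards [hK.isClosed.isOpen_compl.mem_nhds hx] with y hy using hφ0 y hy
    rw [this.gradient_eq, gradient_fun_const]
  have hgrad (x) (hx : x ∈ Metric.ball x0 R) :
      gradient φ x = (2 * max (V x - u x) 0) • (X x - gradient u x) := by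
    have hd : HasGradientAt u (gradient u x) x :=
      ((huAt x hx).differentiableAt (by norm_num)).hasGradientAt
    rw [(hφeq x hx).gradient_eq]
    refine HasGradientAt.gradient ?_
    rw [hasGradientAt_iff_hasFDerivAt]
    have h1 := (hV x hx).hasFDerivAt.sub hd.hasFDerivAt
    have h2 := (hasDerivAt_posPart_sq (V x - u x)).comp_hasFDerivAt x h1
    refine h2.congr_fderiv ?_
    simp
  have hφcont := hφC.continuous
  have hgcont (x) : ContinuousAt (gradient φ) x :=
    continuousAt_gradient_of_contDiffAt hφC.contDiffAt
  have hdivcont (x) (hx : x ∈ K) : ContinuousAt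
      (fun y => ∑ i, (fderiv ℝ X y (EuclideanSpace.single i 1)) i) x := by
    have := (hX x (hKB hx)).continuousAt_fderiv (by norm_num)
    fun_prop
  have hposAt (x) (hx : x ∈ K) : 0 < u x := hupos x (hball (hKB hx))
  -- integrability of all the terms involved
  have i1 : Integrable fun x => ⟪gradient u x, gradient φ x⟫ :=
    integrable_of_continuousAt_of_eq_zero hK (fun x hx => by simp [hg0 x hx])
      fun x hx => (continuousAt_gradient_of_contDiffAt (huAt x (hKB hx))).inner (𝕜 := ℝ) (hgcont x)
  have i2 : Integrable fun x => ⟪x, gradient u x⟫ / ‖x‖ ^ 2 * φ x :=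
    integrable_of_continuousAt_of_eq_zero hK (fun x hx => by simp [hφ0 x hx])
      fun x hx => (continuousAt_drift (hne x (hKB hx)) (huAt x (hKB hx))).mul hφcont.continuousAt
  have i3 : Integrable fun x => Gt τ x (u x) (gradient u x) * φ x :=
    integrable_of_continuousAt_of_eq_zero hK (fun x hx => by simp [hφ0 x hx])
      fun x hx => (continuousAt_Gt hτ1 (hne x (hKB hx)) (huAt x (hKB hx)) (hposAt x hx)).mul
        hφcont.continuousAt
  have i4 : Integrable fun x => ‖x‖ ^ θ * u x ^ q * φ x :=
    integrable_of_continuousAt_of_eq_zero hK (fun x hx => by simp [hφ0 x hx])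
      fun x hx => (continuousAt_absorption (hne x (hKB hx)) (huAt x (hKB hx)) (hposAt x hx)).mul
        hφcont.continuousAt
  have i5 : Integrable fun x => ⟪X x, gradient φ x⟫ :=
    integrable_of_continuousAt_of_eq_zero hK (fun x hx => by simp [hg0 x hx])
      fun x hx => (hX x (hKB hx)).continuousAt.inner (𝕜 := ℝ) (hgcont x)
  have i6 : Integrable fun x => (∑ i, (fderiv ℝ X x (EuclideanSpace.single i 1)) i) * φ x :=
    integrable_of_continuousAt_of_eq_zero hK (fun x hx => by simp [hφ0 x hx])
      fun x hx => (hdivcont x hx).mul hφcont.continuousAt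
  have hnotK {x} (hx : x ∉ Ω \ {0}) : x ∉ K := fun h => hx (hball (hKB h))
  have hw := hweak φ ⟨hφC, hφc, hφsupp.trans (hKB.trans hball)⟩ hφnn
  unfold weakE at hw
  rw [setIntegral_eq_integral_of_forall_compl_eq_zero fun x hx => by simp [hg0 x (hnotK hx)],
    setIntegral_eq_integral_of_forall_compl_eq_zero fun x hx => by simp [hφ0 x (hnotK hx)],
    setIntegral_eq_integral_of_forall_compl_eq_zero fun x hx => by simp [hφ0 x (hnotK hx)],
    setIntegral_eq_integral_of_forall_compl_eq_zero fun x hx => by simp [hφ0 x (hnotK hx)]] at hw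
  have hmono : ∫ x, ⟪gradient u x, gradient φ x⟫ ≤ ∫ x, ⟪X x, gradient φ x⟫ := by
    refine integral_mono i1 i5 fun x => ?_
    by_cases hx : x ∈ K
    · have : 0 ≤ ⟪X x - gradient u x, gradient φ x⟫ := by
        rw [hgrad x (hKB hx), real_inner_smul_right]
        have := real_inner_self_nonneg (x := X x - gradient u x)
        positivity
      rw [inner_sub_left] at this
      linarith
    · simp [hg0 x hx]
  have hdiv : ∫ x, ⟪X x, gradient φ x⟫
      = -∫ x, (∑ i, (fderiv ℝ X x (EuclideanSpace.single i 1)) i) * φ x := by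
    have hY0 (x) (hx : x ∉ K) : φ x • X x = 0 := by simp [hφ0 x hx]
    have hYC : ContDiff ℝ 1 fun x => φ x • X x :=
      contDiff_of_contDiffAt_of_eq_zero hK hY0 fun x hx => hφC.contDiffAt.smul (hX x (hKB hx))
    have h := integral_divergence_eq_zero hYC (hφc.smul_right)
    have heq : (fun x => ∑ i, (fderiv ℝ (fun y => φ y • X y) x (EuclideanSpace.single i 1)) i)
        = fun x => ⟪X x, gradient φ x⟫
          + (∑ i, (fderiv ℝ X x (EuclideanSpace.single i 1)) i) * φ x := by
      funext x
      by_cases hx : x ∈ K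
      · exact divergence_smul (hφC.differentiable (by norm_num) x)
          ((hX x (hKB hx)).differentiableAt (by norm_num))
      · have : (fun y => φ y • X y) =ᶠ[𝓝 x] fun _ => 0 := by
          filter_upwards [hK.isClosed.isOpen_compl.mem_nhds hx] with y hy using hY0 y hy
        rw [this.fderiv_eq]
        simp [hφ0 x hx, hg0 x hx]
    rw [heq, integral_add i5 i6] at h
    linarith
  have hpos : 0 < ∫ x, ((∑ i, (fderiv ℝ X x (EuclideanSpace.single i 1)) i)
      - lowerOrderE N ρ lam τ θ q u x) * φ x := by
    have hF0 (x) (hx : x ∉ K) : ((∑ i, (fderiv ℝ X x (EuclideanSpace.single i 1)) i)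
      - lowerOrderE N ρ lam τ θ q u x) * φ x = 0 := by simp [hφ0 x hx]
    have hx0 : x0 ∈ Metric.ball x0 R := Metric.mem_ball_self (hs.trans hsR)
    refine Continuous.integral_pos_of_hasCompactSupport_nonneg_nonzero (x := x0) ?_ ?_ ?_ ?_
    · refine continuous_of_tsupport fun x hx => ?_
      have hxK : x ∈ K := hφsupp (closure_mono (Function.support_mul_subset_right _ _) hx)
      exact ((hdivcont x hxK).sub (continuousAt_lowerOrderE hτ1 (hne x (hKB hxK))
        (huAt x (hKB hxK)) (hposAt x hxK))).mul hφcont.continuousAt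
    · exact hφc.mul_left
    · intro x
      by_cases hx : x ∈ K
      · exact mul_nonneg (sub_nonneg.2 (hsub x (hKB hx)).le) (hφnn x)
      · exact (hF0 x hx).ge
    · have : 0 < φ x0 := by
        simp only [hφdef, if_pos hx0]
        rw [max_eq_left (sub_pos.2 hin).le]
        exact pow_pos (sub_pos.2 hin) 2
      exact (mul_pos (sub_pos.2 (hsub x0 hx0)) this).ne'
  have hsplit : ∫ x, ((∑ i, (fderiv ℝ X x (EuclideanSpace.single i 1)) i)
      - lowerOrderE N ρ lam τ θ q u x) * φ x
      = (∫ x, (∑ i, (fderiv ℝ X x (EuclideanSpace.single i 1)) i) * φ x)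
        - (((N : ℝ) - 2 + 2 * ρ) * (∫ x, ⟪x, gradient u x⟫ / ‖x‖ ^ 2 * φ x)
        - lam * (∫ x, Gt τ x (u x) (gradient u x) * φ x) + ∫ x, ‖x‖ ^ θ * u x ^ q * φ x) := by
    have j2 := i2.const_mul ((N : ℝ) - 2 + 2 * ρ)
    have j3 := i3.const_mul lam
    have e1 := integral_sub j2 j3
    have e2 := integral_add (j2.sub j3) i4
    have e3 := integral_sub i6 ((j2.sub j3).add i4)
    rw [← integral_const_mul, ← integral_const_mul, ← e1]
    refine Eq.trans ?_ (e3.trans (congrArg _ e2))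
    refine integral_congr_ae (Eventually.of_forall fun x => ?_)
    simp only [lowerOrderE, Pi.sub_apply, Pi.add_apply]
    ring
  linarith

/-- A `C¹` super-solution is a super-solution in the viscosity sense: if a `C²` function `V` with
gradient `X` touches `u` from below at `x0`, then `div X` is controlled at `x0`. -/
lemma divergence_le_of_touching {N : ℕ} {ρ lam τ θ q : ℝ} (hτ1 : τ < 1)
    {Ω : Set (EuclideanSpace ℝ (Fin N))} (hΩ : IsOpen Ω)
    {u : EuclideanSpace ℝ (Fin N) → ℝ} (hu : IsSuperSolutionE N ρ lam τ θ q Ω u)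
    {x0 : EuclideanSpace ℝ (Fin N)} (hx0 : x0 ∈ Ω \ {0})
    {V : EuclideanSpace ℝ (Fin N) → ℝ} {X : EuclideanSpace ℝ (Fin N) → EuclideanSpace ℝ (Fin N)}
    (hV : ∀ᶠ x in 𝓝 x0, HasGradientAt V (X x) x) (hX : ContDiffAt ℝ 1 X x0)
    (hle : ∀ᶠ x in 𝓝 x0, V x ≤ u x) (heq : V x0 = u x0) :
    ∑ i, (fderiv ℝ X x0 (EuclideanSpace.single i 1)) i ≤ lowerOrderE N ρ lam τ θ q u x0 := by
  by_contra! hlt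
  have hopen : IsOpen (Ω \ {0}) := hΩ.sdiff isClosed_singleton
  obtain ⟨η, hη, hηlt⟩ : ∃ η : ℝ, 0 < η ∧ lowerOrderE N ρ lam τ θ q u x0
      < (∑ i, (fderiv ℝ X x0 (EuclideanSpace.single i 1)) i) - 2 * η * N := by
    set d := (∑ i, (fderiv ℝ X x0 (EuclideanSpace.single i 1)) i)
      - lowerOrderE N ρ lam τ θ q u x0 with hd
    have hdpos : 0 < d := sub_pos.2 hlt
    refine ⟨d / (2 * (N + 1)), by positivity, ?_⟩
    have : 2 * (d / (2 * ((N : ℝ) + 1))) * N < d := by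
      have : 2 * (d / (2 * ((N : ℝ) + 1))) * N = d * (N / (N + 1)) := by field_simp
      rw [this]
      exact mul_lt_of_lt_one_right hdpos (by rw [div_lt_one (by positivity)]; linarith)
    linarith
  have hX' : ∀ᶠ x in 𝓝 x0, ContDiffAt ℝ 1 X x := hX.eventually (by simp)
  have hucont : ContinuousAt (lowerOrderE N ρ lam τ θ q u) x0 :=
    continuousAt_lowerOrderE hτ1 (fun h => hx0.2 (by simp [h]))
      (hu.1.1.contDiffAt (hopen.mem_nhds hx0)) (hu.1.2 x0 hx0)
  have hdcont : ContinuousAt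
      (fun y => (∑ i, (fderiv ℝ X y (EuclideanSpace.single i 1)) i) - 2 * η * N) x0 := by
    have := hX.continuousAt_fderiv (by norm_num)
    fun_prop
  have hsub := hucont.eventually_lt hdcont hηlt
  obtain ⟨R, hR, hRball⟩ := Metric.eventually_nhds_iff_ball.1
    ((((hV.and hX').and hle).and hsub).and (hopen.mem_nhds hx0))
  have hs : 0 < R / 2 := by positivity
  refine false_of_local_bump hτ1 hΩ hu hs (half_lt_self hR) (x0 := x0)
    (V := fun x => V x + η * ((R / 2) ^ 2 - ‖x - x0‖ ^ 2))
    (X := fun x => X x - (2 * η) • (x - x0)) (fun x hx => (hRball x hx).2) ?_ ?_ ?_ ?_ ?_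
  · intro x hx
    rw [hasGradientAt_iff_hasFDerivAt]
    have h1 := (hRball x hx).1.1.1.1.hasFDerivAt
    have h2 : HasFDerivAt (fun y => ‖y - x0‖ ^ 2) _ x :=
      ((hasFDerivAt_id x).sub_const x0).norm_sq
    have h3 := h1.add ((h2.const_sub ((R / 2) ^ 2)).const_mul η)
    refine h3.congr_fderiv ?_
    ext y
    simp
    ring
  · intro x hx
    exact (hRball x hx).1.1.1.2.sub (by fun_prop)
  · intro x hx
    have h1 := ((hRball x hx).1.1.1.2.differentiableAt (by norm_num)).hasFDerivAt
    have h2 := h1.sub (((hasFDerivAt_id x).sub_const x0).const_smul (2 * η))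
    have h3 : fderiv ℝ (fun x => X x - (2 * η) • (x - x0)) x = _ := h2.fderiv
    rw [h3]
    refine (hRball x hx).1.2.trans_eq ?_
    simp [Finset.sum_sub_distrib]
    ring
  · intro x hx hxs
    have h1 := (hRball x hx).1.1.2
    rw [Metric.mem_closedBall, not_le, dist_eq_norm] at hxs
    have : (R / 2) ^ 2 ≤ ‖x - x0‖ ^ 2 := by gcongr
    nlinarith
  · simp only [sub_self, norm_zero, heq]
    have : 0 < η * (R / 2) ^ 2 := by positivity
    simpa using this

lemma hasGradientAt_log_norm {N : ℕ} {x : EuclideanSpace ℝ (Fin N)} (hx : x ≠ 0) :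
    HasGradientAt (fun y : EuclideanSpace ℝ (Fin N) => Real.log ‖y‖) ((‖x‖ ^ 2)⁻¹ • x) x := by
  rw [hasGradientAt_iff_hasFDerivAt]
  have hn : ‖x‖ ≠ 0 := norm_ne_zero_iff.2 hx
  have h1 : HasFDerivAt (fun y : EuclideanSpace ℝ (Fin N) => ‖y‖ ^ 2) _ x :=
    (hasFDerivAt_id x).norm_sq
  have h2 := (h1.log (by positivity)).const_mul (1 / 2 : ℝ)
  have h3 : (fun y : EuclideanSpace ℝ (Fin N) => 1 / 2 * Real.log (‖y‖ ^ 2))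
      = fun y => Real.log ‖y‖ := by
    funext y
    rw [Real.log_pow]
    push_cast
    ring
  rw [h3] at h2
  refine h2.congr_fderiv ?_
  ext y
  simp
  ring

/-- The radial function `exp (W (log |x|))` touching a super-solution from below at `x0`. -/
lemma radial_touching_le {N : ℕ} {ρ lam τ θ q : ℝ} (hτ1 : τ < 1)
    {Ω : Set (EuclideanSpace ℝ (Fin N))} (hΩ : IsOpen Ω)
    {u : EuclideanSpace ℝ (Fin N) → ℝ} (hu : IsSuperSolutionE N ρ lam τ θ q Ω u)
    {x0 : EuclideanSpace ℝ (Fin N)} (hx0 : x0 ∈ Ω \ {0}) {W p : ℝ → ℝ} {p' : ℝ}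
    (hW : ∀ᶠ t in 𝓝 (Real.log ‖x0‖), HasDerivAt W (p t) t)
    (hWC : ContDiffAt ℝ 1 W (Real.log ‖x0‖)) (hpC : ContDiffAt ℝ 1 p (Real.log ‖x0‖))
    (hp : HasDerivAt p p' (Real.log ‖x0‖))
    (hle : ∀ᶠ x in 𝓝 x0, Real.exp (W (Real.log ‖x‖)) ≤ u x)
    (heq : Real.exp (W (Real.log ‖x0‖)) = u x0) :
    p' + p (Real.log ‖x0‖) ^ 2 - 2 * ρ * p (Real.log ‖x0‖)
      + lam * |p (Real.log ‖x0‖)| ^ (1 - τ) ≤ ‖x0‖ ^ (θ + 2) * u x0 ^ (q - 1) := by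
  have hne : x0 ≠ 0 := fun h => hx0.2 (by simp [h])
  have hr : 0 < ‖x0‖ := norm_pos_iff.2 hne
  have hopen : IsOpen (Ω \ {0}) := hΩ.sdiff isClosed_singleton
  set Q : ℝ → ℝ := fun t => Real.exp (W t - 2 * t) * p t with hQ
  have hexp {x : EuclideanSpace ℝ (Fin N)} (hx : x ≠ 0) :
      Real.exp (W (Real.log ‖x‖) - 2 * Real.log ‖x‖)
        = Real.exp (W (Real.log ‖x‖)) * (‖x‖ ^ 2)⁻¹ := by
    rw [Real.exp_sub, two_mul, Real.exp_add, Real.exp_log (norm_pos_iff.2 hx), div_eq_mul_inv,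
      sq]
  have hlogC : ContDiffAt ℝ 1 (fun y : EuclideanSpace ℝ (Fin N) => Real.log ‖y‖) x0 :=
    (contDiffAt_norm ℝ hne).log hr.ne'
  have hQC : ContDiffAt ℝ 1 Q (Real.log ‖x0‖) := by
    simp only [hQ]
    fun_prop
  have hQlog : ContDiffAt ℝ 1 (fun y : EuclideanSpace ℝ (Fin N) => Q (Real.log ‖y‖)) x0 :=
    ContDiffAt.comp (g := Q) (f := fun y : EuclideanSpace ℝ (Fin N) => Real.log ‖y‖) x0 hQC hlogC
  have hgradV : ∀ᶠ x in 𝓝 x0, HasGradientAt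
      (fun y : EuclideanSpace ℝ (Fin N) => Real.exp (W (Real.log ‖y‖)))
      (Q (Real.log ‖x‖) • x) x := by
    filter_upwards [hlogC.continuousAt.eventually hW, isOpen_ne.mem_nhds hne] with x hx hx'
    rw [hasGradientAt_iff_hasFDerivAt]
    have h := hx.exp.comp_hasFDerivAt x (hasGradientAt_log_norm hx').hasFDerivAt
    refine h.congr_fderiv ?_
    simp only [hQ, hexp hx']
    ext y
    simp
    ring
  have hvisc := divergence_le_of_touching hτ1 hΩ hu hx0 hgradV (hQlog.smul contDiffAt_id) hle heq
  have hgradu : gradient u x0 = Q (Real.log ‖x0‖) • x0 := by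
    have hdu : HasGradientAt u (gradient u x0) x0 :=
      ((hu.1.1.contDiffAt (hopen.mem_nhds hx0)).differentiableAt (by norm_num)).hasGradientAt
    have hmin : IsLocalMin (fun x => u x - Real.exp (W (Real.log ‖x‖))) x0 := by
      filter_upwards [hle] with x hx
      rw [heq, sub_self]
      exact sub_nonneg.2 hx
    have h := hmin.hasFDerivAt_eq_zero (hdu.hasFDerivAt.sub hgradV.self_of_nhds.hasFDerivAt)
    rw [← map_sub] at h
    exact sub_eq_zero.1 ((LinearIsometryEquiv.map_eq_zero_iff _).1 h)
  set t0 := Real.log ‖x0‖ with ht0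
  have hQ' : HasDerivAt Q (Real.exp (W t0 - 2 * t0) * (p' + p t0 ^ 2 - 2 * p t0)) t0 := by
    have h := ((hW.self_of_nhds.sub ((hasDerivAt_id t0).const_mul 2)).exp).mul hp
    refine h.congr_deriv ?_
    simp
    ring
  have hgradQ : gradient (fun y : EuclideanSpace ℝ (Fin N) => Q (Real.log ‖y‖)) x0
      = (Real.exp (W t0 - 2 * t0) * (p' + p t0 ^ 2 - 2 * p t0)) • ((‖x0‖ ^ 2)⁻¹ • x0) := by
    refine HasGradientAt.gradient ?_
    rw [hasGradientAt_iff_hasFDerivAt]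
    refine (hQ'.comp_hasFDerivAt x0 (hasGradientAt_log_norm hne).hasFDerivAt).congr_fderiv ?_
    simp
  have hdiv : ∑ i, (fderiv ℝ (fun y : EuclideanSpace ℝ (Fin N) => Q (Real.log ‖y‖) • y) x0
      (EuclideanSpace.single i 1)) i
      = Real.exp (W t0 - 2 * t0) * (p' + p t0 ^ 2 - 2 * p t0 + N * p t0) := by
    rw [divergence_smul (X := fun y => y) (hQlog.differentiableAt (by norm_num)) differentiableAt_id,
      hgradQ, real_inner_smul_right, real_inner_smul_right, real_inner_self_eq_norm_sq,
      inv_mul_cancel₀ (by positivity)]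
    simp [← ht0, hQ]
    ring
  have hvisc' : Real.exp (W t0 - 2 * t0) * (p' + p t0 ^ 2 - 2 * p t0 + N * p t0)
      ≤ lowerOrderE N ρ lam τ θ q u x0 := hdiv ▸ hvisc
  have hupos : 0 < u x0 := hu.1.2 x0 hx0
  have hA : Real.exp (W t0 - 2 * t0) = u x0 * (‖x0‖ ^ 2)⁻¹ := by rw [hexp hne, heq]
  have hG : Gt τ x0 (u x0) (gradient u x0) = u x0 * (‖x0‖ ^ 2)⁻¹ * |p t0| ^ (1 - τ) := by
    have e1 : ‖Q t0 • x0‖ = u x0 * ‖x0‖⁻¹ * |p t0| := by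
      rw [norm_smul, hQ]
      simp only [hA, norm_mul, Real.norm_eq_abs, abs_of_pos hupos]
      rw [abs_of_pos (by positivity)]
      field_simp
    rw [Gt, hgradu, e1, Real.mul_rpow (by positivity) (abs_nonneg _),
      Real.mul_rpow hupos.le (by positivity), Real.inv_rpow hr.le,
      Real.rpow_sub hupos, Real.rpow_one, Real.rpow_sub hr, Real.rpow_one, Real.rpow_add hr,
      Real.rpow_one]
    have := (Real.rpow_pos_of_pos hupos τ).ne'
    have := (Real.rpow_pos_of_pos hr τ).ne'
    field_simp
  have hD : ⟪x0, gradient u x0⟫ / ‖x0‖ ^ 2 = u x0 * (‖x0‖ ^ 2)⁻¹ * p t0 := by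
    rw [hgradu, real_inner_smul_right, real_inner_self_eq_norm_sq, hQ]
    simp only [hA]
    field_simp
  have hB : ‖x0‖ ^ θ * u x0 ^ q
      = u x0 * (‖x0‖ ^ 2)⁻¹ * (‖x0‖ ^ (θ + 2) * u x0 ^ (q - 1)) := by
    rw [Real.rpow_add hr, Real.rpow_sub hupos, Real.rpow_one, Real.rpow_two]
    field_simp
  rw [lowerOrderE, hG, hD, hB, hA] at hvisc'
  have hApos : 0 < u x0 * (‖x0‖ ^ 2)⁻¹ := by positivity
  refine le_of_mul_le_mul_left ?_ hApos
  linarith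

/-- The characteristic function `p ↦ f_ρ(-p)` in factored form. -/
lemma fRho_neg {ρ lam τ p : ℝ} (hp : 0 < p) :
    fRho ρ lam τ (-p) = p * (p - 2 * ρ + lam * p ^ (-τ)) := by
  rw [fRho, abs_neg, abs_of_pos hp, sub_eq_add_neg, Real.rpow_add hp, Real.rpow_one]
  ring

/-- At the smallest negative root `-p₁` of `f_ρ`, the derivative has the favourable sign. -/
lemma mul_le_rpow_of_isMinNegRoot {ρ lam τ w1 : ℝ} (hτ0 : 0 ≤ τ) (hw1 : IsMinNegRoot ρ lam τ w1) :
    lam * τ ≤ (-w1) ^ (τ + 1) := by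
  obtain ⟨hneg, hroot, hmin⟩ := hw1
  by_contra! hlt
  have hp1 : 0 < -w1 := by linarith
  have hpow := Real.rpow_pos_of_pos hp1 (τ + 1)
  have hlam : 0 < lam := by
    by_contra! h
    nlinarith
  set k : ℝ → ℝ := fun p => p - 2 * ρ + lam * p ^ (-τ) with hk
  have hk1 : k (-w1) = 0 := by
    have h := fRho_neg (ρ := ρ) (lam := lam) (τ := τ) hp1
    rw [neg_neg, hroot] at h
    exact (mul_eq_zero.1 h.symm).resolve_left hp1.ne'
  have hderiv : HasDerivAt k (1 + lam * (-τ * (-w1) ^ (-τ - 1))) (-w1) :=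
    ((hasDerivAt_id _).sub_const _).add
      ((Real.hasDerivAt_rpow_const (Or.inl hp1.ne')).const_mul lam)
  have hdneg : 1 + lam * (-τ * (-w1) ^ (-τ - 1)) < 0 := by
    have h1 : (-w1) ^ (-τ - 1) * (-w1) ^ (τ + 1) = 1 := by
      rw [← Real.rpow_add hp1]
      simp
    have h2 := Real.rpow_pos_of_pos hp1 (-τ - 1)
    nlinarith [mul_lt_mul_of_pos_left hlt h2]
  obtain ⟨p2, hp2, hkp2⟩ : ∃ p2, -w1 < p2 ∧ k p2 < 0 := by
    have h := (hasDerivAt_iff_tendsto_slope.1 hderiv).eventually (Iio_mem_nhds hdneg)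
    have h' := h.filter_mono (nhdsWithin_mono (-w1) fun y (hy : y ∈ Set.Ioi (-w1)) => ne_of_gt hy)
    obtain ⟨p2, hs, hp2⟩ := (h'.and self_mem_nhdsWithin).exists
    refine ⟨p2, hp2, ?_⟩
    have hs' : slope k (-w1) p2 < 0 := hs
    rw [slope_def_field, hk1, sub_zero, div_lt_iff₀ (sub_pos.2 hp2), zero_mul] at hs'
    exact hs'
  have hcont : ContinuousOn k (Set.Icc p2 (max p2 (2 * ρ))) := by
    intro y hy
    have : 0 < y := hp1.trans (hp2.trans_le hy.1)
    exact ((continuousAt_id.sub continuousAt_const).add (continuousAt_const.mul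
      (Real.continuousAt_rpow_const _ _ (Or.inl this.ne')))).continuousWithinAt
  have hkend : 0 ≤ k (max p2 (2 * ρ)) := by
    have hpos : 0 < max p2 (2 * ρ) := (hp1.trans hp2).trans_le (le_max_left _ _)
    have := mul_pos hlam (Real.rpow_pos_of_pos hpos (-τ))
    have := le_max_right p2 (2 * ρ)
    simp only [hk]
    linarith
  obtain ⟨p3, hp3, hkp3⟩ := intermediate_value_Icc (le_max_left _ _) hcont ⟨hkp2.le, hkend⟩
  have hp3pos : 0 < p3 := hp1.trans (hp2.trans_le hp3.1)
  have := hmin (-p3) (by linarith) (by rw [fRho_neg hp3pos]; exact mul_eq_zero_of_right _ hkp3)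
  linarith [hp3.1]

/-- Quadratic lower bound for `f_ρ` to the left of its smallest negative root. -/
lemma sq_half_le_of_isMinNegRoot {ρ lam τ w1 y : ℝ} (hτ0 : 0 ≤ τ)
    (hw1 : IsMinNegRoot ρ lam τ w1) (hy : 0 ≤ y) :
    y ^ 2 / 2 ≤ (-w1 + y) ^ 2 - 2 * ρ * (-w1 + y) + lam * |-w1 + y| ^ (1 - τ) := by
  have hlt := mul_le_rpow_of_isMinNegRoot hτ0 hw1
  obtain ⟨hneg, hroot, -⟩ := hw1
  obtain ⟨a, ha⟩ : ∃ a, a = -w1 := ⟨_, rfl⟩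
  have ha0 : 0 < a := by linarith
  rw [← ha] at hlt ⊢
  have hp : 0 < a + y := by linarith
  have hr : a - 2 * ρ + lam * a ^ (-τ) = 0 := by
    have h := fRho_neg (ρ := ρ) (lam := lam) (τ := τ) ha0
    rw [ha, neg_neg, hroot, ← ha] at h
    exact (mul_eq_zero.1 h.symm).resolve_left ha0.ne'
  have hrhs : (a + y) ^ 2 - 2 * ρ * (a + y) + lam * |a + y| ^ (1 - τ)
      = (a + y) * (y + lam * ((a + y) ^ (-τ) - a ^ (-τ))) := by
    rw [abs_of_pos hp, sub_eq_add_neg 1 τ, Real.rpow_add hp, Real.rpow_one]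
    linear_combination (a + y) * hr
  rw [hrhs]
  set s := Real.log ((a + y) / a) with hs
  have hs0 : 0 ≤ s := Real.log_nonneg ((one_le_div ha0).2 (by linarith))
  have hes : Real.exp s = (a + y) / a := Real.exp_log (by positivity)
  have hpow : (a + y) ^ (-τ) = a ^ (-τ) * Real.exp (-τ * s) := by
    have : a + y = a * Real.exp s := by rw [hes]; field_simp
    rw [this, Real.mul_rpow ha0.le (Real.exp_pos _).le, ← Real.exp_mul, mul_comm s]
  have hlog : -(a * s) ≤ lam * ((a + y) ^ (-τ) - a ^ (-τ)) := by
    have hap := Real.rpow_pos_of_pos ha0 (-τ)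
    have he : 1 - τ * s ≤ Real.exp (-τ * s) := by linarith [Real.add_one_le_exp (-τ * s)]
    have he1 : Real.exp (-τ * s) ≤ 1 := by
      rw [Real.exp_le_one_iff]
      nlinarith [mul_nonneg hτ0 hs0]
    rw [hpow]
    rcases le_total lam 0 with hl | hl
    · have h1 : 0 ≤ (-lam) * (a ^ (-τ) * (1 - Real.exp (-τ * s))) :=
        mul_nonneg (by linarith) (mul_nonneg hap.le (by linarith))
      nlinarith [mul_nonneg ha0.le hs0]
    · have h1 : lam * τ * a ^ (-τ) ≤ a := by
        have h2 : a ^ (τ + 1) * a ^ (-τ) = a := by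
          rw [← Real.rpow_add ha0]
          simp
        nlinarith [mul_le_mul_of_nonneg_right hlt hap.le]
      nlinarith [mul_le_mul_of_nonneg_right h1 hs0,
        mul_nonneg (mul_nonneg hl hap.le) (sub_nonneg.2 he)]
  have hsinh : s ≤ ((a + y) / a - a / (a + y)) / 2 := by
    have h := Real.self_le_sinh_iff.2 hs0
    rwa [Real.sinh_eq, Real.exp_neg, hes, inv_div] at h
  have hfin : y ^ 2 / 2 ≤ (a + y) * (y - a * s) := by
    have h1 : a * s ≤ a * (((a + y) / a - a / (a + y)) / 2) := by gcongr
    calc y ^ 2 / 2 = (a + y) * (y - a * (((a + y) / a - a / (a + y)) / 2)) := by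
          field_simp
          ring
      _ ≤ _ := by gcongr
  refine hfin.trans ?_
  gcongr
  linarith

/-- Comparison on an annulus with the explicit strict sub-solution
`|x|^(-ϖ₁) exp(|x|^κ) (log(|x|/ε))²`, which vanishes on the inner sphere `|x| = ε`. -/
lemma barrier_le_of_isSuperSolutionE {N : ℕ} {ρ lam τ θ q : ℝ} (hτ0 : 0 ≤ τ) (hτ1 : τ < 1)
    (hq : 1 < q) {Ω : Set (EuclideanSpace ℝ (Fin N))} (hΩ : IsOpen Ω)
    {u : EuclideanSpace ℝ (Fin N) → ℝ} (hu : IsSuperSolutionE N ρ lam τ θ q Ω u)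
    {w1 : ℝ} (hw1 : IsMinNegRoot ρ lam τ w1) {κ : ℝ} (hκ : 0 < κ)
    (hκeq : κ = θ + 2 + -w1 * (q - 1)) {r0 : ℝ} (hr01 : r0 ≤ 1)
    (hr0Ω : Metric.closedBall 0 r0 ⊆ Ω) {m m0 : ℝ} (hm : 0 < m)
    (hm0 : ∀ x : EuclideanSpace ℝ (Fin N), ‖x‖ = r0 → m0 ≤ u x) (hmm0 : m * Real.exp 1 ≤ m0)
    (hmκ : (m * Real.exp 1) ^ (q - 1) ≤ κ ^ 2) {ε : ℝ} (hε : 0 < ε) (hεr0 : ε < r0)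
    {x : EuclideanSpace ℝ (Fin N)} (hxε : ε < ‖x‖) (hxr0 : ‖x‖ ≤ r0) :
    m * (‖x‖ ^ (-w1) * Real.exp (‖x‖ ^ κ) * (Real.log ‖x‖ - Real.log ε) ^ 2)
      ≤ (Real.log r0 - Real.log ε) ^ 2 * u x := by
  by_contra! hcontra
  have hneg : w1 < 0 := hw1.1
  have ha : 0 < -w1 := by linarith
  set a := -w1
  set L := Real.log r0 - Real.log ε
  have hLpos : 0 < L := sub_pos.2 (Real.log_lt_log hε hεr0)
  set v : EuclideanSpace ℝ (Fin N) → ℝ :=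
    fun x => ‖x‖ ^ a * Real.exp (‖x‖ ^ κ) * (Real.log ‖x‖ - Real.log ε) ^ 2 with hv
  set K := Metric.closedBall (0 : EuclideanSpace ℝ (Fin N)) r0 ∩ {y | ε ≤ ‖y‖}
  have hK : IsCompact K :=
    (isCompact_closedBall _ _).inter_right (isClosed_le continuous_const continuous_norm)
  have hKr (y) (hy : y ∈ K) : ε ≤ ‖y‖ ∧ ‖y‖ ≤ r0 := ⟨hy.2, by simpa using hy.1⟩
  have hKΩ (y) (hy : y ∈ K) : y ∈ Ω \ {0} :=
    ⟨hr0Ω hy.1, fun h => by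
      have h1 := (hKr y hy).1
      rw [Set.mem_singleton_iff.1 h, norm_zero] at h1
      linarith⟩
  have hopen : IsOpen (Ω \ {0}) := hΩ.sdiff isClosed_singleton
  have hupos (y) (hy : y ∈ K) : 0 < u y := hu.1.2 y (hKΩ y hy)
  have hcont : ContinuousOn (fun y => v y / u y) K := by
    intro y hy
    have hn : ‖y‖ ≠ 0 := (hε.trans_le (hKr y hy).1).ne'
    have huc : ContinuousAt u y := (hu.1.1.contDiffAt (hopen.mem_nhds (hKΩ y hy))).continuousAt
    have hnc : ContinuousAt (fun z : EuclideanSpace ℝ (Fin N) => ‖z‖) y := continuous_norm.continuousAt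
    exact ((((hnc.rpow_const (Or.inl hn)).mul (hnc.rpow_const (Or.inl hn)).rexp).mul
      (((hnc.log hn).sub continuousAt_const).pow 2)).div huc (hupos y hy).ne').continuousWithinAt
  have hxK : x ∈ K := ⟨by simpa using hxr0, hxε.le⟩
  obtain ⟨x0, hx0K, hmax⟩ := hK.exists_isMaxOn ⟨x, hxK⟩ hcont
  set M := v x0 / u x0 with hM
  have hMlt : L ^ 2 / m < M := by
    have h1 : v x / u x ≤ M := hmax hxK
    refine lt_of_lt_of_le ?_ h1
    rw [div_lt_div_iff₀ hm (hupos x hxK)]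
    linarith [hcontra]
  have hMpos : 0 < M := lt_trans (by positivity) hMlt
  have hux0 := hupos x0 hx0K
  have hvM : v x0 = M * u x0 := by rw [hM]; field_simp
  have hvx0 : L ^ 2 * u x0 < m * v x0 := by
    rw [div_lt_iff₀ hm] at hMlt
    rw [hvM]
    nlinarith
  have hr : 0 < ‖x0‖ := hε.trans_le (hKr x0 hx0K).1
  have hr1 : ‖x0‖ ≤ 1 := (hKr x0 hx0K).2.trans hr01
  have hlog_nonneg : 0 ≤ Real.log ‖x0‖ - Real.log ε :=
    sub_nonneg.2 (Real.log_le_log hε (hKr x0 hx0K).1)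
  have hlog_le : Real.log ‖x0‖ - Real.log ε ≤ L :=
    sub_le_sub_right (Real.log_le_log hr (hKr x0 hx0K).2) _
  have hvle : v x0 ≤ ‖x0‖ ^ a * Real.exp 1 * L ^ 2 := by
    simp only [hv]
    gcongr
    exact Real.rpow_le_one hr.le hr1 hκ.le
  have hult : u x0 < m * Real.exp 1 * ‖x0‖ ^ a := by
    have h1 : L ^ 2 * u x0 < L ^ 2 * (m * Real.exp 1 * ‖x0‖ ^ a) := by
      calc L ^ 2 * u x0 < m * v x0 := hvx0
        _ ≤ m * (‖x0‖ ^ a * Real.exp 1 * L ^ 2) := by gcongr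
        _ = _ := by ring
    exact lt_of_mul_lt_mul_left h1 (by positivity)
  have hx0r0 : ‖x0‖ < r0 := by
    refine lt_of_le_of_ne (hKr x0 hx0K).2 fun h => ?_
    have h1 := hm0 x0 h
    have h2 : ‖x0‖ ^ a ≤ 1 := Real.rpow_le_one hr.le hr1 ha.le
    have h3 : m * Real.exp 1 * ‖x0‖ ^ a ≤ m * Real.exp 1 :=
      mul_le_of_le_one_right (by positivity) h2
    linarith
  have hx0ε : ε < ‖x0‖ := by
    refine lt_of_le_of_ne (hKr x0 hx0K).1 fun h => ?_
    have : v x0 = 0 := by simp [hv, ← h]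
    rw [hvM] at this
    exact (mul_pos hMpos hux0).ne' this
  have hTlt : Real.log ε < Real.log ‖x0‖ := Real.log_lt_log hε hx0ε
  set T := Real.log ε with hT
  set t0 := Real.log ‖x0‖ with ht0
  set W : ℝ → ℝ := fun t => -Real.log M + a * t + Real.exp (κ * t) + 2 * Real.log (t - T) with hW
  set p : ℝ → ℝ := fun t => a + (κ * Real.exp (κ * t) + 2 / (t - T)) with hp
  have hexpW {y : EuclideanSpace ℝ (Fin N)} (hy : ε < ‖y‖) :
      Real.exp (W (Real.log ‖y‖)) = v y / M := by
    have hy0 : 0 < ‖y‖ := hε.trans hy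
    have hyT : 0 < Real.log ‖y‖ - T := sub_pos.2 (Real.log_lt_log hε hy)
    simp only [hW, hv]
    rw [Real.exp_add, Real.exp_add, Real.exp_add, Real.exp_neg, Real.exp_log hMpos,
      mul_comm κ, ← Real.rpow_def_of_pos hy0, mul_comm a, ← Real.rpow_def_of_pos hy0,
      mul_comm (2 : ℝ), ← Real.rpow_def_of_pos hyT, Real.rpow_two]
    field_simp
  have hkey := radial_touching_le (W := W) (p := p)
    (p' := κ ^ 2 * Real.exp (κ * t0) - 2 / (t0 - T) ^ 2) hτ1 hΩ hu (hKΩ x0 hx0K)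
    (by
      filter_upwards [Ioi_mem_nhds hTlt] with t ht
      have ht' : t - T ≠ 0 := (sub_pos.2 ht).ne'
      have h1 := ((hasDerivAt_id t).const_mul a).const_add (-Real.log M)
      have h2 := ((hasDerivAt_id t).const_mul κ).exp
      have h3 := (((hasDerivAt_id t).sub_const T).log ht').const_mul 2
      refine ((h1.add h2).add h3).congr_deriv ?_
      simp only [hp, id]
      ring)
    (by
      have : t0 - T ≠ 0 := (sub_pos.2 hTlt).ne'
      simp only [hW]
      fun_prop (disch := assumption))
    (by
      have : t0 - T ≠ 0 := (sub_pos.2 hTlt).ne'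
      simp only [hp]
      fun_prop (disch := assumption))
    (by
      have ht' : t0 - T ≠ 0 := (sub_pos.2 hTlt).ne'
      have h2 := (((hasDerivAt_id t0).const_mul κ).exp).const_mul κ
      have h3 := (hasDerivAt_const t0 (2 : ℝ)).div ((hasDerivAt_id t0).sub_const T) ht'
      refine ((h2.add h3).const_add a).congr_deriv ?_
      simp only [id]
      ring)
    (by
      filter_upwards [continuous_norm.continuousAt.eventually_lt continuousAt_const hx0r0,
        continuousAt_const.eventually_lt continuous_norm.continuousAt hx0ε] with y hy1 hy2
      have hyK : y ∈ K := ⟨by simpa using hy1.le, hy2.le⟩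
      have h1 : v y / u y ≤ M := hmax hyK
      rw [hexpW hy2, div_le_iff₀ hMpos]
      rw [div_le_iff₀ (hupos y hyK)] at h1
      linarith)
    (by rw [hexpW hx0ε, hvM]; field_simp)
  have htT : 0 < t0 - T := sub_pos.2 hTlt
  have hy0 : 0 ≤ κ * Real.exp (κ * t0) + 2 / (t0 - T) := by positivity
  have hquad := sq_half_le_of_isMinNegRoot hτ0 hw1 hy0
  have hrκ : Real.exp (κ * t0) = ‖x0‖ ^ κ := by rw [Real.rpow_def_of_pos hr, mul_comm]
  have hlow : κ ^ 2 * ‖x0‖ ^ κ ≤ ‖x0‖ ^ (θ + 2) * u x0 ^ (q - 1) := by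
    refine le_trans ?_ hkey
    have h1 : 2 / (t0 - T) ^ 2 ≤ (κ * Real.exp (κ * t0) + 2 / (t0 - T)) ^ 2 / 2 := by
      have h2 : (2 / (t0 - T)) ^ 2 ≤ (κ * Real.exp (κ * t0) + 2 / (t0 - T)) ^ 2 := by
        gcongr
        exact le_add_of_nonneg_left (by positivity)
      have h3 : (2 / (t0 - T)) ^ 2 = 2 * (2 / (t0 - T) ^ 2) := by
        field_simp
      linarith
    rw [← hrκ]
    simp only [hp]
    linarith
  have hup : ‖x0‖ ^ (θ + 2) * u x0 ^ (q - 1) < κ ^ 2 * ‖x0‖ ^ κ := by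
    have h1 : u x0 ^ (q - 1) < (m * Real.exp 1 * ‖x0‖ ^ a) ^ (q - 1) :=
      Real.rpow_lt_rpow hux0.le hult (by linarith)
    have h2 : (m * Real.exp 1 * ‖x0‖ ^ a) ^ (q - 1)
        = (m * Real.exp 1) ^ (q - 1) * ‖x0‖ ^ (a * (q - 1)) := by
      rw [Real.mul_rpow (by positivity) (by positivity), ← Real.rpow_mul hr.le]
    calc ‖x0‖ ^ (θ + 2) * u x0 ^ (q - 1)
        < ‖x0‖ ^ (θ + 2) * ((m * Real.exp 1) ^ (q - 1) * ‖x0‖ ^ (a * (q - 1))) := by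
          rw [← h2]; gcongr
      _ ≤ ‖x0‖ ^ (θ + 2) * (κ ^ 2 * ‖x0‖ ^ (a * (q - 1))) := by gcongr
      _ = κ ^ 2 * ‖x0‖ ^ κ := by
          rw [hκeq, Real.rpow_add hr (θ + 2)]
          ring
  linarith

/-- If `β > ϖ₁` in Case [N₁] or Case [N₂], then every positive super-solution
`u` of (E) in `Ω \ {0}` satisfies `liminf_{|x|→0} |x|^{ϖ₁} u(x) > 0`. -/
theorem stmt9_liminf_pos
    (N : ℕ) (hN : 2 ≤ N) (ρ lam τ θ q : ℝ)
    (hτ0 : 0 ≤ τ) (hτ1 : τ < 1) (hq : 1 < q)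
    (Ω : Set (EuclideanSpace ℝ (Fin N))) (hΩ : IsOpen Ω) (h0 : (0 : EuclideanSpace ℝ (Fin N)) ∈ Ω)
    (hcase : CaseN1 ρ lam τ ∨ CaseN2 ρ lam τ)
    (w1 : ℝ) (hw1 : IsMinNegRoot ρ lam τ w1)
    (hβ : w1 < (θ + 2) / (q - 1))
    (u : EuclideanSpace ℝ (Fin N) → ℝ)
    (hu : IsSuperSolutionE N ρ lam τ θ q Ω u) :
    ∃ m : ℝ, 0 < m ∧ ∀ᶠ x in 𝓝[≠] (0 : EuclideanSpace ℝ (Fin N)),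
      m ≤ ‖x‖ ^ w1 * u x := by
  have hneg : w1 < 0 := hw1.1
  obtain ⟨κ, hκeq⟩ : ∃ κ, κ = θ + 2 + -w1 * (q - 1) := ⟨_, rfl⟩
  have hκ : 0 < κ := by
    rw [lt_div_iff₀ (by linarith)] at hβ
    linarith
  obtain ⟨r0, hr0, hr01, hr0Ω⟩ : ∃ r0 : ℝ, 0 < r0 ∧ r0 ≤ 1 ∧ Metric.closedBall 0 r0 ⊆ Ω := by
    obtain ⟨r, hr, hrΩ⟩ := Metric.nhds_basis_closedBall.mem_iff.1 (hΩ.mem_nhds h0)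
    exact ⟨min r 1, lt_min hr one_pos, min_le_right _ _,
      (Metric.closedBall_subset_closedBall (min_le_left _ _)).trans hrΩ⟩
  obtain ⟨m0, hm0pos, hm0⟩ : ∃ m0 : ℝ, 0 < m0 ∧
      ∀ x : EuclideanSpace ℝ (Fin N), ‖x‖ = r0 → m0 ≤ u x := by
    have hsub : Metric.sphere (0 : EuclideanSpace ℝ (Fin N)) r0 ⊆ Ω \ {0} := fun x hx =>
      ⟨hr0Ω (Metric.sphere_subset_closedBall hx), fun h => by
        have h1 : ‖x‖ = r0 := by simpa using hx
        rw [Set.mem_singleton_iff.1 h, norm_zero] at h1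
        exact hr0.ne h1⟩
    rcases (Metric.sphere (0 : EuclideanSpace ℝ (Fin N)) r0).eq_empty_or_nonempty with he | hne
    · refine ⟨1, one_pos, fun x hx => ?_⟩
      have : x ∈ Metric.sphere (0 : EuclideanSpace ℝ (Fin N)) r0 := by simpa using hx
      simp [he] at this
    · obtain ⟨y, hy, hmin⟩ := (isCompact_sphere (0 : EuclideanSpace ℝ (Fin N)) r0).exists_isMinOn
        hne (hu.1.1.continuousOn.mono hsub)
      exact ⟨u y, hu.1.2 y (hsub hy), fun x hx => hmin (by simpa using hx)⟩
  obtain ⟨m, hm, hmm0, hmκ⟩ : ∃ m : ℝ, 0 < m ∧ m * Real.exp 1 ≤ m0 ∧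
      (m * Real.exp 1) ^ (q - 1) ≤ κ ^ 2 := by
    have hb : 0 < (κ ^ 2) ^ (q - 1)⁻¹ := by positivity
    have hc : 0 < min m0 ((κ ^ 2) ^ (q - 1)⁻¹) := lt_min hm0pos hb
    have he : min m0 ((κ ^ 2) ^ (q - 1)⁻¹) / Real.exp 1 * Real.exp 1
        = min m0 ((κ ^ 2) ^ (q - 1)⁻¹) := div_mul_cancel₀ _ (Real.exp_pos 1).ne'
    refine ⟨min m0 ((κ ^ 2) ^ (q - 1)⁻¹) / Real.exp 1, by positivity, ?_, ?_⟩
    · rw [he]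
      exact min_le_left _ _
    · rw [he]
      calc (min m0 ((κ ^ 2) ^ (q - 1)⁻¹)) ^ (q - 1)
          ≤ ((κ ^ 2) ^ (q - 1)⁻¹) ^ (q - 1) :=
            Real.rpow_le_rpow hc.le (min_le_right _ _) (by linarith)
        _ = κ ^ 2 := Real.rpow_inv_rpow (by positivity) (by linarith)
  refine ⟨m / 4, by positivity, ?_⟩
  filter_upwards [self_mem_nhdsWithin, nhdsWithin_le_nhds (Metric.ball_mem_nhds 0 hr0)]
    with x hx hxr0
  have hr : 0 < ‖x‖ := norm_pos_iff.2 hx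
  have hrr0 : ‖x‖ < r0 := by simpa using hxr0
  have hεr : ‖x‖ ^ 2 / r0 < ‖x‖ := by
    rw [div_lt_iff₀ hr0, sq]
    exact mul_lt_mul_of_pos_left hrr0 hr
  have h := barrier_le_of_isSuperSolutionE hτ0 hτ1 hq hΩ hu hw1 hκ hκeq hr01 hr0Ω hm hm0 hmm0 hmκ
    (by positivity) (hεr.trans hrr0) hεr hrr0.le
  have hl : 0 < Real.log r0 - Real.log ‖x‖ := sub_pos.2 (Real.log_lt_log hr hrr0)
  rw [Real.log_div (by positivity) hr0.ne', Real.log_pow] at h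
  have h1 : m * ‖x‖ ^ (-w1) ≤ 4 * u x := by
    have he : 1 ≤ Real.exp (‖x‖ ^ κ) := Real.one_le_exp (by positivity)
    have h2 : m * ‖x‖ ^ (-w1) * (Real.log r0 - Real.log ‖x‖) ^ 2
        ≤ 4 * u x * (Real.log r0 - Real.log ‖x‖) ^ 2 := by
      calc m * ‖x‖ ^ (-w1) * (Real.log r0 - Real.log ‖x‖) ^ 2
          ≤ m * ‖x‖ ^ (-w1) * (Real.log r0 - Real.log ‖x‖) ^ 2 * Real.exp (‖x‖ ^ κ) :=
            le_mul_of_one_le_right (by positivity) he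
        _ ≤ _ := by
            push_cast at h
            linarith
    exact le_of_mul_le_mul_right h2 (by positivity)
  have hcancel : ‖x‖ ^ w1 * ‖x‖ ^ (-w1) = 1 := by
    rw [← Real.rpow_add hr]
    simp
  have h3 := mul_le_mul_of_nonneg_left h1 (Real.rpow_pos_of_pos hr w1).le
  linear_combination h3 / 4 - m / 4 * hcancel

end
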